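/- Let Γ : ℝ → ℝ³ be a 1-periodic Lipschitz curve, injective on [0,1), with positive length, and let v₁, v₂ be affine lines in ℝ³ such that Rot(2π/a₁, v₁) and Rot(2π/a₂, v₂) each map the image Γ(ℝ) onto itself, where a₁, a₂ ≥ 2 are integers. If v₁ ∩ v₂ = {p} consists of a single point (so in particular v₁ ≠ v₂) and the rotational angles agree, 2π/a₁ = 2π/a₂, then a₁ = a₂ = 2, i.e. both rotational angles equal π. -/

import Mathlib

open MeasureTheory Real Set
open scoped ENNReal NNReal RealInnerProductSpace

/-- Rotation of `ℝ³` by angle `β` about the line through the origin with (unit) direction `u`,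
given by Rodrigues' formula
`x ↦ cos β · x + sin β · (u × x) + (1 − cos β)⟨u, x⟩ u`. -/
noncomputable def rotAxisDir (β : ℝ) (u x : EuclideanSpace ℝ (Fin 3)) :
    EuclideanSpace ℝ (Fin 3) :=
  Real.cos β • x
    + Real.sin β • ((WithLp.equiv 2 (Fin 3 → ℝ)).symm
        (crossProduct (WithLp.equiv 2 (Fin 3 → ℝ) u) (WithLp.equiv 2 (Fin 3 → ℝ) x)))
    + ((1 - Real.cos β) * ⟪u, x⟫) • u

/-- Rotation `Rot(β, ℓ)` of `ℝ³` by angle `β` about the affine line `ℓ = p + ℝu`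
(`u` a unit direction): `x ↦ p + R(x − p)` with `R` the rotation by `β` fixing `u`. -/
noncomputable def rotLine (β : ℝ) (p u : EuclideanSpace ℝ (Fin 3))
    (x : EuclideanSpace ℝ (Fin 3)) : EuclideanSpace ℝ (Fin 3) :=
  p + rotAxisDir β u (x - p)

/-- The action of a `3×3` matrix on `ℝ³` (as a Euclidean space). -/
noncomputable def mulVecE (S : Matrix (Fin 3) (Fin 3) ℝ) (x : EuclideanSpace ℝ (Fin 3)) :
    EuclideanSpace ℝ (Fin 3) :=
  (WithLp.equiv 2 (Fin 3 → ℝ)).symm (S.mulVec (WithLp.equiv 2 (Fin 3 → ℝ) x))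

/-- The affine line `p + ℝu` in `ℝ³`. -/
def affLine (p u : EuclideanSpace ℝ (Fin 3)) : Set (EuclideanSpace ℝ (Fin 3)) :=
  {x | ∃ c : ℝ, x = p + c • u}

section ClosedCurve

variable {E : Type*}

/-- A periodic curve that is injective on a period takes equal values only at times differing by
an integer. -/
theorem Function.Periodic.exists_int_eq_add_of_injOn {Γ : ℝ → E} (hper : Function.Periodic Γ 1)
    (hinj : InjOn Γ (Ico 0 1)) {s t : ℝ} (h : Γ s = Γ t) : ∃ n : ℤ, s = t + n := by
  have hfract (x : ℝ) : Γ (Int.fract x) = Γ x := by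
    simpa only [zsmul_one, Int.self_sub_floor] using hper.sub_zsmul_eq (x := x) ⌊x⌋
  have hst : Int.fract s = Int.fract t :=
    hinj ⟨Int.fract_nonneg _, Int.fract_lt_one _⟩ ⟨Int.fract_nonneg _, Int.fract_lt_one _⟩
      (by rw [hfract, hfract, h])
  obtain ⟨n, hn⟩ := Int.fract_eq_fract.1 hst
  exact ⟨n, by linarith⟩

/-- A continuous path running in the image of a closed embedded curve can be reparametrized
through that curve. -/
theorem Function.Periodic.exists_continuous_lift [TopologicalSpace E] [T2Space E] {Γ : ℝ → E}
    (hper : Function.Periodic Γ 1) (hcont : Continuous Γ) (hinj : InjOn Γ (Ico 0 1))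
    {h : ℝ → E} (hh : Continuous h) (hrange : ∀ t, h t ∈ range Γ) :
    ∃ φ : ℝ → ℝ, Continuous φ ∧ ∀ t, Γ (φ t) = h t := by
  choose σ hσ using hrange
  let G : AddCircle (1 : ℝ) → E := hper.lift
  have hG (t : ℝ) : G (t : AddCircle (1 : ℝ)) = Γ t := hper.lift_coe t
  have hGcont : Continuous G := continuous_coinduced_dom.2 hcont
  have hGinj : Function.Injective G := by
    intro a b
    induction a using QuotientAddGroup.induction_on with | H a => ?_
    induction b using QuotientAddGroup.induction_on with | H b => ?_
    intro hab
    obtain ⟨n, rfl⟩ := hper.exists_int_eq_add_of_injOn hinj (hab : Γ a = Γ b)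
    change ((b + n : ℝ) : AddCircle (1 : ℝ)) = b
    rw [AddCircle.coe_add, show (n : ℝ) = n • (1 : ℝ) by simp, AddCircle.coe_zsmul,
      AddCircle.coe_period, smul_zero, add_zero]
  have hemb := hGcont.isClosedEmbedding hGinj
  let k : C(ℝ, AddCircle (1 : ℝ)) := ⟨fun t ↦ (σ t : AddCircle (1 : ℝ)), by
    rw [hemb.isEmbedding.continuous_iff]
    convert hh using 1
    ext t
    exact (hG _).trans (hσ t)⟩
  obtain ⟨φ, ⟨-, hφ⟩, -⟩ := (AddCircle.isCoveringMap_coe (1 : ℝ)).existsUnique_continuousMap_lifts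
    k 0 (σ 0) rfl
  refine ⟨φ, φ.continuous, fun t ↦ ?_⟩
  have ht : (φ t : AddCircle (1 : ℝ)) = σ t := congr_fun hφ t
  rw [← hG, ht, hG, hσ]

/-- A continuous self-map of the line that lifts the identity of a closed embedded curve is an
integer translation. -/
theorem Function.Periodic.exists_int_translation {Γ : ℝ → E}
    (hper : Function.Periodic Γ 1) (hinj : InjOn Γ (Ico 0 1))
    {φ : ℝ → ℝ} (hφ : Continuous φ) (h : ∀ t, Γ (φ t) = Γ t) : ∃ n : ℤ, ∀ t, φ t = t + n := by
  choose d hd using fun t ↦ hper.exists_int_eq_add_of_injOn hinj (h t)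
  have hdcont : Continuous d := by
    rw [Int.isClosedEmbedding_coe_real.isEmbedding.continuous_iff]
    have : (Int.cast ∘ d : ℝ → ℝ) = fun t ↦ φ t - t := by
      ext t
      simp [hd t]
    rw [this]
    fun_prop
  refine ⟨d 0, fun t ↦ ?_⟩
  rw [hd t, PreconnectedSpace.constant inferInstance hdcont (x := t) (y := 0)]

/-- An isometry preserving a closed embedded curve acts on it through a homeomorphism of the
parameter line. -/
theorem Isometry.exists_bijective_lift [MetricSpace E] {Γ : ℝ → E} {g : E → E} (hg : Isometry g)
    (hper : Function.Periodic Γ 1) (hcont : Continuous Γ) (hinj : InjOn Γ (Ico 0 1))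
    (himage : g '' range Γ = range Γ) :
    ∃ φ : ℝ → ℝ, Continuous φ ∧ Function.Bijective φ ∧ ∀ t, Γ (φ t) = g (Γ t) := by
  obtain ⟨φ, hφ, hφΓ⟩ := hper.exists_continuous_lift hcont hinj (hg.continuous.comp hcont)
    fun t ↦ himage ▸ mem_image_of_mem g (mem_range_self t)
  have hpre (t : ℝ) : ∃ x ∈ range Γ, g x = Γ t := by
    have := mem_range_self (f := Γ) t
    rwa [← himage] at this
  choose k hk hgk using hpre
  have hkcont : Continuous k := by
    rw [hg.isEmbedding.continuous_iff]
    exact hcont.congr fun t ↦ (hgk t).symm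
  obtain ⟨ψ, hψ, hψΓ⟩ := hper.exists_continuous_lift hcont hinj hkcont hk
  obtain ⟨m, hm⟩ := hper.exists_int_translation hinj (hφ.comp hψ) fun t ↦ by
    simp only [Function.comp_apply] at hφΓ ⊢
    rw [hφΓ, hψΓ, hgk]
  obtain ⟨n, hn⟩ := hper.exists_int_translation hinj (hψ.comp hφ) fun t ↦ by
    simp only [Function.comp_apply] at hφΓ ⊢
    apply hg.injective
    rw [hψΓ, hgk, hφΓ]
  refine ⟨φ, hφ, ⟨fun s t hst ↦ ?_, fun t ↦ ⟨ψ (t - m), ?_⟩⟩, hφΓ⟩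
  · have hs := hn s
    have ht := hn t
    simp only [Function.comp_apply] at hs ht
    rw [hst] at hs
    linarith
  · have := hm (t - m)
    simp only [Function.comp_apply] at this
    linarith

/-- The arc-length function of a closed embedded curve is strictly increasing. -/
theorem strictMono_variationOnFromTo [MetricSpace E] {Γ : ℝ → E}
    (hper : Function.Periodic Γ 1) (hinj : InjOn Γ (Ico 0 1))
    (hbv : LocallyBoundedVariationOn Γ univ) :
    StrictMono (variationOnFromTo Γ univ 0) := by
  intro x y hxy
  refine lt_of_le_of_ne
    (variationOnFromTo.monotoneOn hbv (mem_univ _) (mem_univ _) (mem_univ _) hxy.le) fun heq ↦ ?_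
  rw [variationOnFromTo.eq_left_iff hbv (mem_univ _) (mem_univ _) (mem_univ _),
    variationOnFromTo.eq_zero_iff_of_le hbv (mem_univ _) (mem_univ _) hxy.le] at heq
  obtain ⟨z, hxz, hz⟩ := exists_between (lt_min hxy (lt_add_one x))
  rw [lt_min_iff] at hz
  have hΓ : Γ z = Γ x := edist_eq_zero.1
    (heq ⟨mem_univ _, hxz.le, hz.1.le⟩ ⟨mem_univ _, le_rfl, hxy.le⟩)
  obtain ⟨n, hn⟩ := hper.exists_int_eq_add_of_injOn hinj hΓ
  have h0 : (0 : ℝ) < n := by linarith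
  have h1 : (n : ℝ) < 1 := by linarith
  norm_cast at h0 h1
  omega

/-- A reparametrization of a curve that differs from it by an isometry preserves arc length up to
orientation. -/
theorem exists_variationOnFromTo_comp_eq [MetricSpace E] {Γ : ℝ → E} {g : E → E} (hg : Isometry g)
    (hbv : LocallyBoundedVariationOn Γ univ) {φ : ℝ → ℝ} (hφ : Continuous φ)
    (hbij : Function.Bijective φ) (h : ∀ t, Γ (φ t) = g (Γ t)) :
    ∃ c : ℝ, (∀ t, variationOnFromTo Γ univ 0 (φ t) = c + variationOnFromTo Γ univ 0 t) ∨
      ∀ t, variationOnFromTo Γ univ 0 (φ t) = c - variationOnFromTo Γ univ 0 t := by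
  have hcomp : Γ ∘ φ = g ∘ Γ := funext h
  have hvar (s : Set ℝ) : eVariationOn (g ∘ Γ) s = eVariationOn Γ s := by
    simp [eVariationOn, hg.edist_eq]
  have hadd (t : ℝ) : variationOnFromTo Γ univ 0 (φ t) = variationOnFromTo Γ univ 0 (φ 0) +
      variationOnFromTo Γ univ (φ 0) (φ t) :=
    (variationOnFromTo.add hbv (mem_univ _) (mem_univ _) (mem_univ _)).symm
  refine ⟨variationOnFromTo Γ univ 0 (φ 0), ?_⟩
  rcases hφ.strictMono_of_inj hbij.1 with hmono | hanti
  · refine .inl fun t ↦ ?_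
    rw [hadd]
    congr 1
    have := variationOnFromTo.comp_eq_of_monotoneOn Γ φ (hmono.monotone.monotoneOn univ)
      (mem_univ 0) (mem_univ t)
    rw [image_univ, hbij.2.range_eq, hcomp] at this
    rw [← this]
    simp [variationOnFromTo, hvar]
  · refine .inr fun t ↦ ?_
    rw [hadd, sub_eq_add_neg]
    congr 1
    have himage (x y : ℝ) : eVariationOn Γ (Icc (φ y) (φ x)) = eVariationOn Γ (Icc x y) := by
      have : φ '' Icc x y = Icc (φ y) (φ x) := by
        ext z
        obtain ⟨w, rfl⟩ := hbij.2 z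
        rw [hbij.1.mem_set_image]
        simp [hanti.le_iff_ge, and_comm]
      rw [← this, ← eVariationOn.comp_eq_of_antitoneOn Γ φ (hanti.antitone.antitoneOn _), hcomp,
        hvar]
    rcases le_total 0 t with ht | ht
    · rw [variationOnFromTo.eq_of_le _ _ ht, variationOnFromTo.eq_of_ge _ _ (hanti.antitone ht),
        univ_inter, univ_inter, himage]
    · rw [variationOnFromTo.eq_of_ge _ _ ht, variationOnFromTo.eq_of_le _ _ (hanti.antitone ht),
        univ_inter, univ_inter, himage, neg_neg]

/-- Two isometric symmetries of a rectifiable closed embedded curve commute along it, unless one of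
them is an involution of it. -/
theorem Isometry.comm_or_involutive_on_range [MetricSpace E] {Γ : ℝ → E} {f g : E → E}
    (hf : Isometry f) (hg : Isometry g) (hper : Function.Periodic Γ 1) (hcont : Continuous Γ)
    (hinj : InjOn Γ (Ico 0 1)) (hbv : LocallyBoundedVariationOn Γ univ)
    (hfΓ : f '' range Γ = range Γ) (hgΓ : g '' range Γ = range Γ) :
    (∀ t, f (g (Γ t)) = g (f (Γ t))) ∨ (∀ t, f (f (Γ t)) = Γ t) ∨ ∀ t, g (g (Γ t)) = Γ t := by
  have hF := (strictMono_variationOnFromTo hper hinj hbv).injective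
  obtain ⟨φ, hφ, hφbij, hφΓ⟩ := hf.exists_bijective_lift hper hcont hinj hfΓ
  obtain ⟨ψ, hψ, hψbij, hψΓ⟩ := hg.exists_bijective_lift hper hcont hinj hgΓ
  obtain ⟨c, hc | hc⟩ := exists_variationOnFromTo_comp_eq hf hbv hφ hφbij hφΓ
  · obtain ⟨d, hd | hd⟩ := exists_variationOnFromTo_comp_eq hg hbv hψ hψbij hψΓ
    · refine .inl fun t ↦ ?_
      have : φ (ψ t) = ψ (φ t) := hF (by rw [hc, hd, hd, hc]; ring)
      rw [← hψΓ, ← hφΓ, this, hψΓ, hφΓ]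
    · refine .inr (.inr fun t ↦ ?_)
      have : ψ (ψ t) = t := hF (by rw [hd, hd]; ring)
      rw [← hψΓ, ← hψΓ, this]
  · refine .inr (.inl fun t ↦ ?_)
    have : φ (φ t) = t := hF (by rw [hc, hc]; ring)
    rw [← hφΓ, ← hφΓ, this]

/-- A closed embedded curve is not contained in a line. -/
theorem Function.Periodic.exists_ne_add_smul [NormedAddCommGroup E] [InnerProductSpace ℝ E]
    {Γ : ℝ → E} (hper : Function.Periodic Γ 1) (hcont : Continuous Γ) (hinj : InjOn Γ (Ico 0 1))
    (q e : E) : ∃ t, ∀ c : ℝ, Γ t - q ≠ c • e := by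
  by_contra! hline
  choose c hc using hline
  have hΓ {s t : ℝ} (h : ⟪e, Γ s - q⟫ = ⟪e, Γ t - q⟫) : Γ s = Γ t := by
    rw [← sub_left_inj (a := q)]
    rw [hc s, hc t, inner_smul_right, inner_smul_right] at h
    rw [hc s, hc t]
    rcases eq_or_ne e 0 with rfl | he
    · simp
    · rw [mul_right_cancel₀ (inner_self_ne_zero.2 he) h]
  let F : ℝ → ℝ := fun t ↦ ⟪e, Γ t - q⟫
  have hFcont : Continuous F := by fun_prop
  -- the values at `0 = 1` and `1/2` are joined along both halves of the circle
  have h01 : F 1 = F 0 := by simp only [F]; rw [← hper 0, zero_add]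
  have hne : F 0 ≠ F (1 / 2) := fun h ↦ by
    have := hinj (by norm_num) (by norm_num) (hΓ h)
    norm_num at this
  have hmid : ∃ s ∈ Icc (0 : ℝ) (1 / 2), F s = (F 0 + F (1 / 2)) / 2 := by
    have := intermediate_value_uIcc (f := F) (a := 0) (b := 1 / 2) hFcont.continuousOn
    rw [uIcc_of_le (by norm_num : (0 : ℝ) ≤ 1 / 2)] at this
    refine this ?_
    rw [mem_uIcc]
    rcases le_total (F 0) (F (1 / 2)) with h | h
    · left; constructor <;> linarith
    · right; constructor <;> linarith
  have hmid' : ∃ s ∈ Icc (1 / 2 : ℝ) 1, F s = (F 0 + F (1 / 2)) / 2 := by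
    have := intermediate_value_uIcc (f := F) (a := 1 / 2) (b := 1) hFcont.continuousOn
    rw [uIcc_of_le (by norm_num : (1 / 2 : ℝ) ≤ 1), h01] at this
    refine this ?_
    rw [mem_uIcc]
    rcases le_total (F 0) (F (1 / 2)) with h | h
    · right; constructor <;> linarith
    · left; constructor <;> linarith
  obtain ⟨s, hs, hFs⟩ := hmid
  obtain ⟨t, ht, hFt⟩ := hmid'
  have hs2 : s ≠ 1 / 2 := by
    rintro rfl
    exact hne (by linarith)
  have ht1 : t ≠ 1 := by
    rintro rfl
    exact hne (by linarith)
  have hst := hinj ⟨hs.1, by linarith [hs.2]⟩ ⟨by linarith [ht.1], lt_of_le_of_ne ht.2 ht1⟩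
    (hΓ (hFs.trans hFt.symm))
  exact hs2 (le_antisymm hs.2 (hst ▸ ht.1))

end ClosedCurve

section Rotation

open Matrix

theorem exists_smul_eq_of_crossProduct_eq_zero {e x : Fin 3 → ℝ} (he : e ≠ 0)
    (h : e ⨯₃ x = 0) : ∃ r : ℝ, x = r • e := by
  have hee : e ⬝ᵥ e ≠ 0 := fun h ↦ he (dotProduct_self_eq_zero.1 h)
  refine ⟨(e ⬝ᵥ x) / (e ⬝ᵥ e), ?_⟩
  have key : (e ⬝ᵥ e) • x = (e ⬝ᵥ x) • e - e ⨯₃ (e ⨯₃ x) := by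
    ext i
    fin_cases i <;> simp [cross_apply, vec3_dotProduct] <;> ring
  rw [h, map_zero, sub_zero] at key
  rw [div_eq_inv_mul, mul_smul, ← key, inv_smul_smul₀ hee]

/-- Rodrigues' formula on `Fin 3 → ℝ`, with `c` and `s` the cosine and sine of the angle. -/
def rodrigues (c s : ℝ) (u x : Fin 3 → ℝ) : Fin 3 → ℝ :=
  c • x + s • (u ⨯₃ x) + ((1 - c) * (u ⬝ᵥ x)) • u

theorem rodrigues_commutator (c s : ℝ) (u v x : Fin 3 → ℝ) :
    rodrigues c s u (rodrigues c s v x) - rodrigues c s v (rodrigues c s u x) =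
      (s ^ 2 - (1 - c) ^ 2 * (u ⬝ᵥ v)) • ((u ⨯₃ v) ⨯₃ x) +
        (s * (1 - c)) • (((u + v) ⬝ᵥ x) • (u ⨯₃ v) + ((u ⨯₃ v) ⬝ᵥ x) • (u + v)) := by
  ext i
  fin_cases i <;>
    simp only [rodrigues, cross_apply, vec3_dotProduct, Pi.add_apply, Pi.sub_apply, Pi.smul_apply,
      smul_eq_mul, cons_val, Fin.zero_eta, Fin.mk_one, Fin.reduceFinMk] <;>
    ring

/-- The vectors on which the rotations by the same angle about two distinct axes commute all lie
on one line. -/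
theorem exists_smul_eq_of_rodrigues_comm {c s : ℝ} (hc : c ≠ 1) (hs : s ≠ 0) {u v : Fin 3 → ℝ}
    (huv : u ⨯₃ v ≠ 0) : ∃ e : Fin 3 → ℝ, ∀ x,
      rodrigues c s u (rodrigues c s v x) = rodrigues c s v (rodrigues c s u x) →
        ∃ r : ℝ, x = r • e := by
  set w := u ⨯₃ v with hw
  set z := u + v with hz
  set α := s ^ 2 - (1 - c) ^ 2 * (u ⬝ᵥ v)
  set k := s * (1 - c)
  have hk : k ≠ 0 := mul_ne_zero hs (sub_ne_zero.2 hc.symm)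
  have hz0 : z ≠ 0 := fun h ↦ huv <| by
    rw [hw, eq_neg_of_add_eq_zero_right h, map_neg, cross_self, neg_zero]
  have hww : w ⬝ᵥ w ≠ 0 := fun h ↦ huv (dotProduct_self_eq_zero.1 h)
  have hzz : z ⬝ᵥ z ≠ 0 := fun h ↦ hz0 (dotProduct_self_eq_zero.1 h)
  have hwz : w ⬝ᵥ z = 0 := by
    simp only [hw, hz, cross_apply, vec3_dotProduct, Pi.add_apply, cons_val]
    ring
  set y := α • (z ⨯₃ w) + (k * (z ⬝ᵥ z)) • w
  have he : z ⨯₃ y ≠ 0 := fun h ↦ by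
    have key : w ⬝ᵥ (z ⨯₃ (z ⨯₃ y)) =
        (z ⬝ᵥ y) * (w ⬝ᵥ z) - (z ⬝ᵥ z) * (α * (w ⬝ᵥ (z ⨯₃ w)) + k * (z ⬝ᵥ z) * (w ⬝ᵥ w)) := by
      rw [cross_cross_eq_smul_sub_smul']
      simp only [y, dotProduct_sub, dotProduct_smul, dotProduct_add, smul_eq_mul]
    rw [h, map_zero, dotProduct_zero, hwz, dot_cross_self] at key
    have : (z ⬝ᵥ z) * (z ⬝ᵥ z) * k * (w ⬝ᵥ w) = 0 := by linear_combination key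
    exact mul_ne_zero (mul_ne_zero (mul_ne_zero hzz hzz) hk) hww this
  refine ⟨z ⨯₃ y, fun x hx ↦ exists_smul_eq_of_crossProduct_eq_zero he ?_⟩
  have hM := rodrigues_commutator c s u v x
  rw [hx, sub_self] at hM
  have hzx : z ⬝ᵥ x = 0 := by
    have := congr_arg (w ⬝ᵥ ·) hM
    simp only [dotProduct_zero, dotProduct_add, dotProduct_smul, smul_eq_mul, ← hw, ← hz, hwz,
      dot_self_cross] at this
    have hprod : (z ⬝ᵥ x) * (k * (w ⬝ᵥ w)) = 0 := by linear_combination -this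
    exact (mul_eq_zero.1 hprod).resolve_right (mul_ne_zero hk hww)
  have hyx : y ⬝ᵥ x = 0 := by
    have := congr_arg (z ⬝ᵥ ·) hM
    simp only [dotProduct_zero, dotProduct_add, dotProduct_smul, smul_eq_mul, ← hw, ← hz,
      dotProduct_comm z w, hwz] at this
    have h3 : z ⬝ᵥ (w ⨯₃ x) = (z ⨯₃ w) ⬝ᵥ x := by
      simp only [cross_apply, vec3_dotProduct, cons_val]
      ring
    simp only [y, add_dotProduct, smul_dotProduct, smul_eq_mul, ← h3]
    linear_combination -this
  rw [cross_cross_eq_smul_sub_smul, hzx, hyx]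
  simp

/-- A vector fixed by the square of a rotation whose angle is not a multiple of `π` lies on the
axis. -/
theorem exists_smul_eq_of_rodrigues_rodrigues_eq_self {c s : ℝ} (hs : s ≠ 0)
    (hcs : c ^ 2 + s ^ 2 = 1) {u x : Fin 3 → ℝ} (hu : u ⬝ᵥ u = 1)
    (h : rodrigues c s u (rodrigues c s u x) = x) : ∃ r : ℝ, x = r • u := by
  refine exists_smul_eq_of_crossProduct_eq_zero (by rintro rfl; simp at hu) ?_
  have hc : c ^ 2 = 1 - s ^ 2 := by linarith
  have hcross (a : Fin 3 → ℝ) :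
      u ⨯₃ rodrigues c s u a = c • (u ⨯₃ a) + s • (u ⨯₃ (u ⨯₃ a)) := by
    simp [rodrigues]
  have huuu : u ⨯₃ (u ⨯₃ (u ⨯₃ x)) = -(u ⨯₃ x) := by
    rw [cross_cross_eq_smul_sub_smul', hu, dot_self_cross]
    simp
  have hsq := congr_arg (u ⨯₃ ·) h
  simp only [hcross, map_add, map_smul, huuu] at hsq
  have hdot := congr_arg ((u ⨯₃ x) ⬝ᵥ ·) hsq
  simp only [dotProduct_add, dotProduct_smul, dotProduct_neg, smul_eq_mul, dot_cross_self] at hdot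
  rw [← dotProduct_self_eq_zero]
  have : s ^ 2 * ((u ⨯₃ x) ⬝ᵥ (u ⨯₃ x)) = 0 := by
    linear_combination (-1 / 2) * hdot + (1 / 2) * ((u ⨯₃ x) ⬝ᵥ (u ⨯₃ x)) * hc
  simpa [hs] using this

theorem rodrigues_dotProduct_self {c s : ℝ} (hcs : c ^ 2 + s ^ 2 = 1) {u : Fin 3 → ℝ}
    (hu : u ⬝ᵥ u = 1) (x : Fin 3 → ℝ) :
    rodrigues c s u x ⬝ᵥ rodrigues c s u x = x ⬝ᵥ x := by
  have hcross : (u ⨯₃ x) ⬝ᵥ (u ⨯₃ x) = x ⬝ᵥ x - (u ⬝ᵥ x) ^ 2 := by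
    rw [cross_dot_cross, hu, dotProduct_comm x u]
    ring
  have hxc : x ⬝ᵥ (u ⨯₃ x) = 0 := dot_cross_self _ _
  have hcx : (u ⨯₃ x) ⬝ᵥ x = 0 := by rw [dotProduct_comm, hxc]
  have huc : u ⬝ᵥ (u ⨯₃ x) = 0 := dot_self_cross _ _
  have hcu : (u ⨯₃ x) ⬝ᵥ u = 0 := by rw [dotProduct_comm, huc]
  simp only [rodrigues, dotProduct_add, add_dotProduct, dotProduct_smul, smul_dotProduct,
    smul_eq_mul, hcross, hxc, hcx, huc, hcu, hu, dotProduct_comm x u]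
  linear_combination (x ⬝ᵥ x - (u ⬝ᵥ x) ^ 2) * hcs

theorem rodrigues_sub (c s : ℝ) (u x y : Fin 3 → ℝ) :
    rodrigues c s u (x - y) = rodrigues c s u x - rodrigues c s u y := by
  simp only [rodrigues, map_sub, smul_sub, dotProduct_sub, mul_sub, sub_smul]
  abel

theorem rodrigues_smul_self {c s : ℝ} {u : Fin 3 → ℝ} (hu : u ⬝ᵥ u = 1) (r : ℝ) :
    rodrigues c s u (r • u) = r • u := by
  simp only [rodrigues, map_smul, cross_self, dotProduct_smul, hu, smul_eq_mul, smul_zero,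
    ← smul_assoc, add_zero, ← add_smul]
  congr 1
  ring

theorem rotAxisDir_eq_toLp_rodrigues (β : ℝ) (u x : EuclideanSpace ℝ (Fin 3)) :
    rotAxisDir β u x = WithLp.toLp 2 (rodrigues (cos β) (sin β) u.ofLp x.ofLp) := by
  ext i
  simp [rotAxisDir, rodrigues, PiLp.inner_apply, dotProduct, mul_comm]

theorem dotProduct_ofLp_self_of_norm_eq_one {u : EuclideanSpace ℝ (Fin 3)} (hu : ‖u‖ = 1) :
    u.ofLp ⬝ᵥ u.ofLp = 1 := by
  have := EuclideanSpace.real_norm_sq_eq u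
  rw [hu] at this
  simp [dotProduct, ← pow_two, ← this]

theorem rotAxisDir_sub (β : ℝ) (u x y : EuclideanSpace ℝ (Fin 3)) :
    rotAxisDir β u (x - y) = rotAxisDir β u x - rotAxisDir β u y := by
  simp [rotAxisDir_eq_toLp_rodrigues, rodrigues_sub]

theorem norm_rotAxisDir {u : EuclideanSpace ℝ (Fin 3)} (hu : ‖u‖ = 1) (β : ℝ)
    (x : EuclideanSpace ℝ (Fin 3)) : ‖rotAxisDir β u x‖ = ‖x‖ := by
  have := rodrigues_dotProduct_self (cos_sq_add_sin_sq β) (dotProduct_ofLp_self_of_norm_eq_one hu)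
    x.ofLp
  rw [← sq_eq_sq₀ (norm_nonneg _) (norm_nonneg _), EuclideanSpace.real_norm_sq_eq,
    EuclideanSpace.real_norm_sq_eq, rotAxisDir_eq_toLp_rodrigues]
  simpa only [dotProduct, ← pow_two] using this

theorem isometry_rotLine {u : EuclideanSpace ℝ (Fin 3)} (hu : ‖u‖ = 1) (β : ℝ)
    (p : EuclideanSpace ℝ (Fin 3)) : Isometry (rotLine β p u) := by
  refine Isometry.of_dist_eq fun x y ↦ ?_
  rw [rotLine, rotLine, dist_add_left, dist_eq_norm, ← rotAxisDir_sub, norm_rotAxisDir hu,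
    sub_sub_sub_cancel_right, dist_eq_norm]

/-- A rotation about a line may be computed from any base point of that line. -/
theorem rotLine_eq_of_mem_affLine {u p q : EuclideanSpace ℝ (Fin 3)} (hu : ‖u‖ = 1)
    (hq : q ∈ affLine p u) (β : ℝ) : rotLine β p u = rotLine β q u := by
  obtain ⟨r, rfl⟩ := hq
  ext1 x
  have hfix : rotAxisDir β u (r • u) = r • u := by
    rw [rotAxisDir_eq_toLp_rodrigues, WithLp.ofLp_smul,
      rodrigues_smul_self (dotProduct_ofLp_self_of_norm_eq_one hu)]
    rfl
  rw [rotLine, rotLine, ← sub_sub, rotAxisDir_sub β u (x - p), hfix]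
  abel

/-- Two lines meeting in a single point have linearly independent directions. -/
theorem crossProduct_ne_zero_of_affLine_inter_eq_singleton
    {p₁ u₁ p₂ u₂ q : EuclideanSpace ℝ (Fin 3)} (hu₁ : u₁ ≠ 0) (hu₂ : u₂ ≠ 0)
    (hq : affLine p₁ u₁ ∩ affLine p₂ u₂ = {q}) : u₁.ofLp ⨯₃ u₂.ofLp ≠ 0 := by
  intro h
  obtain ⟨r, hr⟩ := exists_smul_eq_of_crossProduct_eq_zero (by simpa using hu₁) h
  have hr' : u₂ = r • u₁ := WithLp.ofLp_injective 2 hr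
  have hmem : q ∈ affLine p₁ u₁ ∩ affLine p₂ u₂ := hq ▸ mem_singleton q
  obtain ⟨⟨a, ha⟩, b, hb⟩ := hmem
  have : q + u₂ ∈ affLine p₁ u₁ ∩ affLine p₂ u₂ :=
    ⟨⟨a + r, by rw [add_smul, ← add_assoc, ← ha, hr']⟩,
      b + 1, by rw [add_smul, one_smul, ← add_assoc, ← hb]⟩
  rw [hq, mem_singleton_iff, add_eq_left] at this
  exact hu₂ this

end Rotation

/-- if a closed embedded curve of positive length has two axes of rotational
symmetry meeting in a single point with equal rotational angles `2π/a₁ = 2π/a₂`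
(`a₁, a₂ ≥ 2`), then both angles equal `π`, i.e. `a₁ = a₂ = 2`. -/
theorem equal_angle_axes_are_halfturns
    (Γ : ℝ → EuclideanSpace ℝ (Fin 3)) (K : NNReal) (hΓlip : LipschitzWith K Γ)
    (hΓper : Function.Periodic Γ 1) (hΓinj : Set.InjOn Γ (Set.Ico 0 1))
    (hlen : 0 < ∫ τ in (0:ℝ)..1, ‖deriv Γ τ‖)
    (a₁ a₂ : ℕ) (ha₁ : 2 ≤ a₁) (ha₂ : 2 ≤ a₂)
    (p₁ u₁ p₂ u₂ : EuclideanSpace ℝ (Fin 3)) (hu₁ : ‖u₁‖ = 1) (hu₂ : ‖u₂‖ = 1)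
    (hsym₁ : rotLine (2 * Real.pi / a₁) p₁ u₁ '' Set.range Γ = Set.range Γ)
    (hsym₂ : rotLine (2 * Real.pi / a₂) p₂ u₂ '' Set.range Γ = Set.range Γ)
    (hangle : (2 * Real.pi / a₁ : ℝ) = 2 * Real.pi / a₂)
    (q : EuclideanSpace ℝ (Fin 3))
    (hq : affLine p₁ u₁ ∩ affLine p₂ u₂ = {q}) :
    a₁ = 2 ∧ a₂ = 2 := by
  obtain rfl : a₁ = a₂ := by
    have h₁ : (a₁ : ℝ) ≠ 0 := by positivity
    have h₂ : (a₂ : ℝ) ≠ 0 := by positivity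
    rw [div_eq_div_iff h₁ h₂] at hangle
    exact_mod_cast (mul_left_cancel₀ (by positivity) hangle).symm
  rw [and_self]
  by_contra ha
  have ha3 : (3 : ℝ) ≤ a₁ := by
    have : 3 ≤ a₁ := by omega
    exact_mod_cast this
  set β : ℝ := 2 * π / a₁
  have hsin : sin β ≠ 0 := by
    refine (sin_pos_of_pos_of_lt_pi (by positivity) ?_).ne'
    rw [div_lt_iff₀ (by linarith)]
    nlinarith [pi_pos]
  have hcos : cos β ≠ 1 := fun h ↦ hsin (by nlinarith [sin_sq_add_cos_sq β])
  have hmem : q ∈ affLine p₁ u₁ ∩ affLine p₂ u₂ := hq ▸ mem_singleton q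
  rw [rotLine_eq_of_mem_affLine hu₁ hmem.1] at hsym₁
  rw [rotLine_eq_of_mem_affLine hu₂ hmem.2] at hsym₂
  have hcont := hΓlip.continuous
  have hbv : LocallyBoundedVariationOn Γ univ := hΓlip.locallyBoundedVariationOn univ
  have hline (e : Fin 3 → ℝ) (h : ∀ t, ∃ r : ℝ, (Γ t - q).ofLp = r • e) : False := by
    obtain ⟨t, ht⟩ := hΓper.exists_ne_add_smul hcont hΓinj q (WithLp.toLp 2 e)
    obtain ⟨r, hr⟩ := h t
    exact ht r (WithLp.ofLp_injective 2 hr)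
  have hcomp (u v x : EuclideanSpace ℝ (Fin 3)) : rotLine β q u (rotLine β q v x) =
      q + WithLp.toLp 2 (rodrigues (cos β) (sin β) u.ofLp
        (rodrigues (cos β) (sin β) v.ofLp (x - q).ofLp)) := by
    simp [rotLine, rotAxisDir_eq_toLp_rodrigues]
  have hinvol {u : EuclideanSpace ℝ (Fin 3)} (hu : ‖u‖ = 1)
      (h : ∀ t, rotLine β q u (rotLine β q u (Γ t)) = Γ t) : False := by
    refine hline u.ofLp fun t ↦ exists_smul_eq_of_rodrigues_rodrigues_eq_self hsin
      (cos_sq_add_sin_sq β) (dotProduct_ofLp_self_of_norm_eq_one hu) ?_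
    have := h t
    rw [hcomp, ← eq_sub_iff_add_eq'] at this
    exact congr_arg WithLp.ofLp this
  rcases (isometry_rotLine hu₁ β q).comm_or_involutive_on_range (isometry_rotLine hu₂ β q) hΓper
    hcont hΓinj hbv hsym₁ hsym₂ with h | h | h
  · have hcross := crossProduct_ne_zero_of_affLine_inter_eq_singleton
      (norm_ne_zero_iff.1 (by simp [hu₁])) (norm_ne_zero_iff.1 (by simp [hu₂])) hq
    obtain ⟨e, he⟩ := exists_smul_eq_of_rodrigues_comm hcos hsin hcross
    refine hline e fun t ↦ he _ ?_
    have := h t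
    rw [hcomp, hcomp, add_right_inj] at this
    exact congr_arg WithLp.ofLp this
  · exact hinvol hu₁ h
  · exact hinvol hu₂ h
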